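/- Fix integers m, n. In the polynomial ring ℂ[x,y,z] (MvPolynomial (Fin 3) ℂ), set β := x·y·z + 2 − y² − z², α := y·S_{m−1}(β) − (x·z − y)·S_{m−2}(β), and Q := (x·z − y)·S_{n−1}(α) − (S_m(β) − S_{m−1}(β))·S_{n−2}(α). Then Q = 0 if and only if m = 0 and n = −1. -/

import Mathlib

open Polynomial

/-- The normalized Chebyshev polynomials `S k` (`k : ℤ`), determined by
`S 0 = 1`, `S 1 = X`, and the recurrence `S (k + 1) = X * S k - S (k - 1)` for all `k : ℤ`. -/
@[semireducible] noncomputable def chebS (R : Type*) [CommRing R] : ℤ → R[X]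
  | 0 => 1
  | 1 => X
  | (n : ℕ) + 2 => X * chebS R (n + 1) - chebS R n
  | -((n : ℕ) + 1) => X * chebS R (-n) - chebS R (-n + 1)
  termination_by n => Int.natAbs n + Int.natAbs (n - 1)

/-- `β = x*y*z + 2 - y² - z²` in `ℂ[x,y,z]`, where `x, y, z` are the three variables. -/
noncomputable def beta3 : MvPolynomial (Fin 3) ℂ :=
  MvPolynomial.X 0 * MvPolynomial.X 1 * MvPolynomial.X 2 + 2
    - MvPolynomial.X 1 ^ 2 - MvPolynomial.X 2 ^ 2

/-- `α = y * S (m-1) (β) - (x*z - y) * S (m-2) (β)` in `ℂ[x,y,z]`. -/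
noncomputable def alpha3 (m : ℤ) : MvPolynomial (Fin 3) ℂ :=
  MvPolynomial.X 1 * (chebS (MvPolynomial (Fin 3) ℂ) (m - 1)).eval beta3
    - (MvPolynomial.X 0 * MvPolynomial.X 2 - MvPolynomial.X 1)
        * (chebS (MvPolynomial (Fin 3) ℂ) (m - 2)).eval beta3

/-- `Q = (x*z - y) * S (n-1) (α) - (S m (β) - S (m-1) (β)) * S (n-2) (α)` in `ℂ[x,y,z]`. -/
noncomputable def Q3 (m n : ℤ) : MvPolynomial (Fin 3) ℂ :=
  (MvPolynomial.X 0 * MvPolynomial.X 2 - MvPolynomial.X 1)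
      * (chebS (MvPolynomial (Fin 3) ℂ) (n - 1)).eval (alpha3 m)
    - ((chebS (MvPolynomial (Fin 3) ℂ) m).eval beta3
          - (chebS (MvPolynomial (Fin 3) ℂ) (m - 1)).eval beta3)
        * (chebS (MvPolynomial (Fin 3) ℂ) (n - 2)).eval (alpha3 m)

/-- If a ring homomorphism sends `p` to `2`, it sends `S k (p)` to `k + 1`. -/
theorem map_chebS_eval_of_map_eq_two {R T : Type*} [CommRing R] [CommRing T] (f : R →+* T)
    {p : R} (hp : f p = 2) (k : ℤ) : f ((chebS R k).eval p) = k + 1 := by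
  induction k using chebS.induct with
  | case1 => simp [chebS]
  | case2 => simp [chebS, hp]; norm_num
  | case3 k ih₁ ih₂ =>
    rw [chebS]
    simp only [eval_sub, eval_mul, eval_X, map_sub, map_mul, hp, ih₁, ih₂, Int.ofNat_eq_natCast]
    push_cast
    ring
  | case4 k ih₁ ih₂ =>
    rw [chebS]
    simp only [eval_sub, eval_mul, eval_X, map_sub, map_mul, hp, ih₁, ih₂, Int.negSucc_eq]
    push_cast
    ring

theorem chebS_neg_one (R : Type*) [CommRing R] : chebS R (-1) = 0 := by
  have h : chebS R (-1) = X * chebS R (-(0 : ℕ)) - chebS R (-(0 : ℕ) + 1) := by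
    rw [show (-1 : ℤ) = Int.negSucc 0 from rfl, chebS]
  simp [h, chebS]

theorem chebS_neg_two (R : Type*) [CommRing R] : chebS R (-2) = -1 := by
  have h : chebS R (-2) = X * chebS R (-(1 : ℕ)) - chebS R (-(1 : ℕ) + 1) := by
    rw [show (-2 : ℤ) = Int.negSucc 1 from rfl, chebS]
  simp [h, chebS_neg_one, chebS]

theorem chebS_neg_three (R : Type*) [CommRing R] : chebS R (-3) = -X := by
  have h : chebS R (-3) = X * chebS R (-(2 : ℕ)) - chebS R (-(2 : ℕ) + 1) := by
    rw [show (-3 : ℤ) = Int.negSucc 2 from rfl, chebS]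
  simp [h, chebS_neg_one, chebS_neg_two]

/-- On the surface `β = 2`, the polynomial `α` is linear in `y` and `x * z - y`. -/
theorem eval_alpha3_of_eval_beta3 {v : Fin 3 → ℂ} (hv : MvPolynomial.eval v beta3 = 2) (m : ℤ) :
    MvPolynomial.eval v (alpha3 m) = m * v 1 - (m - 1) * (v 0 * v 2 - v 1) := by
  simp only [alpha3, map_sub, map_mul, MvPolynomial.eval_X, map_chebS_eval_of_map_eq_two _ hv]
  push_cast
  ring

theorem eval_Q3_two (m n : ℤ) : MvPolynomial.eval ![2, 2, 2] (Q3 m n) = n + 1 := by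
  have hβ : MvPolynomial.eval ![2, 2, 2] beta3 = (2 : ℂ) := by
    simp [beta3]; norm_num
  have hα : MvPolynomial.eval ![2, 2, 2] (alpha3 m) = (2 : ℂ) := by
    rw [eval_alpha3_of_eval_beta3 hβ]
    simp
    ring
  simp only [Q3, map_sub, map_mul, MvPolynomial.eval_X, map_chebS_eval_of_map_eq_two _ hβ,
    map_chebS_eval_of_map_eq_two _ hα]
  simp
  ring

theorem Q3_neg_one (m : ℤ) : Q3 m (-1) =
    ((chebS (MvPolynomial (Fin 3) ℂ) m).eval beta3
      - (chebS (MvPolynomial (Fin 3) ℂ) (m - 1)).eval beta3) * alpha3 m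
    - (MvPolynomial.X 0 * MvPolynomial.X 2 - MvPolynomial.X 1) := by
  rw [Q3, show (-1 - 1 : ℤ) = -2 from rfl, show (-1 - 2 : ℤ) = -3 from rfl, chebS_neg_two,
    chebS_neg_three]
  simp only [eval_neg, eval_one, eval_X]
  ring

theorem eval_Q3_neg_one (m : ℤ) :
    MvPolynomial.eval ![5 / 2, 1, 2] (Q3 m (-1)) = -3 * (m : ℂ) := by
  have hβ : MvPolynomial.eval ![5 / 2, 1, 2] beta3 = (2 : ℂ) := by
    simp [beta3]; norm_num
  simp only [Q3_neg_one, map_sub, map_mul, MvPolynomial.eval_X,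
    map_chebS_eval_of_map_eq_two _ hβ, eval_alpha3_of_eval_beta3 hβ]
  simp
  ring

theorem Q3_zero_neg_one : Q3 0 (-1) = 0 := by
  rw [Q3_neg_one, alpha3]
  simp [chebS_neg_one, chebS_neg_two, chebS]

/-- `Q = 0` if and only if `m = 0` and `n = -1`. -/
theorem Q3_eq_zero_iff (m n : ℤ) : Q3 m n = 0 ↔ m = 0 ∧ n = -1 := by
  constructor
  · intro h
    have hn : n = -1 := by
      have := eval_Q3_two m n
      rw [h, map_zero] at this
      have : n + 1 = 0 := by exact_mod_cast this.symm
      lia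
    subst hn
    have hm := eval_Q3_neg_one m
    rw [h, map_zero] at hm
    exact ⟨by simpa using hm, rfl⟩
  · rintro ⟨rfl, rfl⟩
    exact Q3_zero_neg_one
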